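/- arXiv:2103.09047 — 6 statements merged into one kernel-verified Lean document; each statement's English description precedes it below -/
import Mathlib

section
/- (Theorem 1.) For every p ∈ ℕ, the (N+p)×(N+p) Hankel matrix H_{0,N+p} has rank exactly N; in particular the rank of the Hankel matrix of moments equals the number of zeros and poles counted as distinct points. -/
open Matrix in
/-- A Hankel matrix of size at least `N` built from the power sums of `N` distinct nodes with
nonzero weights has rank `N`. -/
theorem Matrix.rank_hankel_weighted_pow_sum {K : Type*} [Field K] {N : ℕ} (p : ℕ)
    {w x : Fin N → K} (hw : ∀ j, w j ≠ 0) (hx : Function.Injective x) :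
    (Matrix.of fun a b : Fin (N + p) => ∑ j, w j * x j ^ ((a : ℕ) + (b : ℕ))).rank = N := by
  have factor (M : ℕ) : (Matrix.of fun a b : Fin M => ∑ j, w j * x j ^ ((a : ℕ) + (b : ℕ))) =
      (Matrix.of fun j (a : Fin M) => x j ^ (a : ℕ))ᵀ *
        (diagonal w * Matrix.of fun j (a : Fin M) => x j ^ (a : ℕ)) := by
    ext a b
    rw [mul_apply, of_apply]
    refine Finset.sum_congr rfl fun j _ => ?_
    rw [diagonal_mul, transpose_apply, of_apply, of_apply, pow_add]
    ring
  apply le_antisymm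
  · rw [factor]
    exact (rank_mul_le_right _ _).trans (rank_le_height _)
  · have hdet : (vandermonde x).det ≠ 0 := det_vandermonde_ne_zero_iff.mpr hx
    have hunit : IsUnit (Matrix.of fun a b : Fin N => ∑ j, w j * x j ^ ((a : ℕ) + (b : ℕ))) := by
      rw [factor, isUnit_iff_isUnit_det, isUnit_iff_ne_zero]
      change ((vandermonde x)ᵀ * (diagonal w * vandermonde x)).det ≠ 0
      rw [det_mul, det_mul, det_transpose, det_diagonal]
      exact mul_ne_zero hdet (mul_ne_zero (Finset.prod_ne_zero_iff.mpr fun j _ => hw j) hdet)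
    have hrank := rank_of_isUnit _ hunit
    rw [Fintype.card_fin] at hrank
    exact hrank.symm.le.trans (rank_submatrix_le
      (Matrix.of fun a b : Fin (N + p) => ∑ j, w j * x j ^ ((a : ℕ) + (b : ℕ)))
      (Fin.castAdd p) (Fin.castAdd p))

/-- **Theorem 1.** For every `p ∈ ℕ`, the `(N+p)×(N+p)` Hankel matrix of moments
`H₀,N+p` has rank exactly `N`: the rank of the Hankel matrix equals the number of
zeros and poles counted as distinct points. -/
theorem hankel_rank_eq_number_of_zeros_and_poles
    (N : ℕ) (hN : 1 ≤ N)
    (γ₀ Δγ : ℕ) (hΔγ : 1 ≤ Δγ)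
    (ζ : Fin N → ℂ) (hζ : ∀ j, ζ j ≠ 0)
    (hdist : Function.Injective fun j : Fin N => ζ j ^ Δγ)
    (n : Fin N → ℤ) (hn : ∀ j, n j ≠ 0)
    (G : ℕ → ℂ) (hG : ∀ k, G k = ∑ j, (n j : ℂ) * ζ j ^ (γ₀ + k * Δγ)) :
    ∀ p : ℕ,
      (Matrix.of fun a b : Fin (N + p) => G ((a : ℕ) + (b : ℕ))).rank = N := by
  intro p
  have hw (j : Fin N) : (n j : ℂ) * ζ j ^ γ₀ ≠ 0 :=
    mul_ne_zero (Int.cast_ne_zero.mpr (hn j)) (pow_ne_zero _ (hζ j))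
  refine Eq.trans ?_ (Matrix.rank_hankel_weighted_pow_sum p hw hdist)
  congr 1
  ext a b
  rw [Matrix.of_apply, Matrix.of_apply, hG]
  refine Finset.sum_congr rfl fun j _ => ?_
  rw [pow_add, ← pow_mul, mul_comm Δγ, mul_assoc]
end

section
/- (Theorem 2, eigenvector part.) For each i ∈ {1,…,N}, the vector x_i = (Vᵀ)⁻¹e_i (where e_i is the i-th standard basis vector) is nonzero and satisfies the generalized eigenvalue equation H_{1,N} x_i = ζ_i^{Δγ} H_{0,N} x_i. -/
open Matrix

/-- A Hankel matrix of exponential moments with nodes `z` and weights `w` factors through the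
Vandermonde matrix of `z`. -/
theorem hankel_eq_vandermonde_mul_diagonal_mul {R : Type*} [CommRing R] {N : ℕ}
    (z w : Fin N → R) (H : Matrix (Fin N) (Fin N) R)
    (hH : ∀ a b, H a b = ∑ j, w j * z j ^ ((a : ℕ) + (b : ℕ))) :
    H = (vandermonde z)ᵀ * diagonal w * vandermonde z := by
  ext a b
  rw [hH, mul_apply]
  refine Finset.sum_congr rfl fun j _ => ?_
  rw [mul_diagonal, transpose_apply, vandermonde_apply, vandermonde_apply]
  ring

/-- **Theorem 2, eigenvector part.** For each `i`, the vector `xᵢ = (Vᵀ)⁻¹ eᵢ` is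
nonzero and satisfies the generalized eigenvalue equation
`H₁ xᵢ = ζᵢ^Δγ H₀ xᵢ`. -/
theorem generalized_eigenvector_of_hankel_pencil
    (N : ℕ) (hN : 1 ≤ N)
    (γ₀ Δγ : ℕ) (hΔγ : 1 ≤ Δγ)
    (ζ : Fin N → ℂ) (hζ : ∀ j, ζ j ≠ 0)
    (hdist : Function.Injective fun j : Fin N => ζ j ^ Δγ)
    (n : Fin N → ℤ) (hn : ∀ j, n j ≠ 0)
    (G : ℕ → ℂ) (hG : ∀ k, G k = ∑ j, (n j : ℂ) * ζ j ^ (γ₀ + k * Δγ))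
    (H₀ H₁ V : Matrix (Fin N) (Fin N) ℂ)
    (hH₀ : ∀ a b, H₀ a b = G ((a : ℕ) + (b : ℕ)))
    (hH₁ : ∀ a b, H₁ a b = G ((a : ℕ) + (b : ℕ) + 1))
    (hV : ∀ a b, V a b = ζ b ^ ((a : ℕ) * Δγ)) :
    ∀ (i : Fin N) (x : Fin N → ℂ),
      x = (V.transpose)⁻¹ *ᵥ (Pi.single i 1) →
      x ≠ 0 ∧ H₁ *ᵥ x = ζ i ^ Δγ • (H₀ *ᵥ x) := by
  rintro i x rfl
  set z : Fin N → ℂ := fun j => ζ j ^ Δγ with hz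
  set w : Fin N → ℂ := fun j => (n j : ℂ) * ζ j ^ γ₀ with hw
  have hVz : Vᵀ = vandermonde z := by
    ext a b
    rw [transpose_apply, hV, vandermonde_apply, hz, ← pow_mul, mul_comm]
  have hdet : IsUnit (vandermonde z).det :=
    isUnit_iff_ne_zero.mpr (det_vandermonde_ne_zero_iff.mpr hdist)
  have hH₀z : H₀ = (vandermonde z)ᵀ * diagonal w * vandermonde z := by
    refine hankel_eq_vandermonde_mul_diagonal_mul z w H₀ fun a b => ?_
    rw [hH₀, hG]
    refine Finset.sum_congr rfl fun j _ => ?_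
    simp only [hz, hw]
    ring
  have hH₁z : H₁ = (vandermonde z)ᵀ * diagonal (fun j => w j * z j) * vandermonde z := by
    refine hankel_eq_vandermonde_mul_diagonal_mul z _ H₁ fun a b => ?_
    rw [hH₁, hG]
    refine Finset.sum_congr rfl fun j _ => ?_
    simp only [hz, hw]
    ring
  have hx : vandermonde z *ᵥ (Vᵀ⁻¹ *ᵥ Pi.single i 1) = Pi.single i 1 := by
    rw [hVz, mulVec_mulVec, mul_nonsing_inv _ hdet, one_mulVec]
  refine ⟨fun h => ?_, ?_⟩
  · rw [h, mulVec_zero] at hx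
    simpa using congrFun hx i
  · rw [hH₀z, hH₁z, ← mulVec_mulVec, ← mulVec_mulVec, ← mulVec_mulVec, ← mulVec_mulVec, hx,
      ← mulVec_smul, diagonal_mulVec_single, diagonal_mulVec_single, ← Pi.single_smul]
    congr 2
    simp only [hz, smul_eq_mul]
    ring
end

section
/- (Theorem 2, eigenvalue characterization.) A complex number λ satisfies det(H_{1,N} − λ H_{0,N}) = 0 if and only if λ = ζ_i^{Δγ} for some i ∈ {1,…,N}. -/
open Matrix in
/-- The weighted Hankel pencil of a sum of geometric progressions factors through the
Vandermonde matrix of its nodes. -/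
theorem Matrix.hankel_pencil_eq_vandermonde_transpose_mul_diagonal_mul {R : Type*} [CommRing R]
    {N : ℕ} (w v : Fin N → R) (c : R) :
    (Matrix.of fun a b : Fin N => ∑ j, w j * v j ^ ((a : ℕ) + b + 1)) -
        c • (Matrix.of fun a b : Fin N => ∑ j, w j * v j ^ ((a : ℕ) + b)) =
      (vandermonde v)ᵀ * diagonal (fun j => w j * (v j - c)) * vandermonde v := by
  ext a b
  rw [mul_apply]
  simp only [sub_apply, smul_apply, of_apply, smul_eq_mul, mul_diagonal, transpose_apply,
    vandermonde_apply, Finset.mul_sum, ← Finset.sum_sub_distrib]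
  exact Finset.sum_congr rfl fun j _ => by ring

open Matrix in
/-- The generalized eigenvalues of a Hankel pencil with nonzero weights and distinct nodes are
the nodes. -/
theorem Matrix.det_hankel_pencil_eq_zero_iff {R : Type*} [CommRing R] [IsDomain R]
    {N : ℕ} {w v : Fin N → R} (hw : ∀ j, w j ≠ 0) (hv : Function.Injective v) (c : R) :
    ((Matrix.of fun a b : Fin N => ∑ j, w j * v j ^ ((a : ℕ) + b + 1)) -
        c • (Matrix.of fun a b : Fin N => ∑ j, w j * v j ^ ((a : ℕ) + b))).det = 0 ↔
      ∃ i, c = v i := by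
  rw [hankel_pencil_eq_vandermonde_transpose_mul_diagonal_mul, det_mul, det_mul, det_transpose,
    det_diagonal]
  simp [det_vandermonde_ne_zero_iff.mpr hv, Finset.prod_eq_zero_iff, hw, sub_eq_zero,
    eq_comm (a := c)]

/-- **Theorem 2, eigenvalue characterization.** A complex number `λ` satisfies
`det (H₁ − λ H₀) = 0` iff `λ = ζᵢ^Δγ` for some `i`. -/
theorem generalized_eigenvalues_of_hankel_pencil
    (N : ℕ) (hN : 1 ≤ N)
    (γ₀ Δγ : ℕ) (hΔγ : 1 ≤ Δγ)
    (ζ : Fin N → ℂ) (hζ : ∀ j, ζ j ≠ 0)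
    (hdist : Function.Injective fun j : Fin N => ζ j ^ Δγ)
    (n : Fin N → ℤ) (hn : ∀ j, n j ≠ 0)
    (G : ℕ → ℂ) (hG : ∀ k, G k = ∑ j, (n j : ℂ) * ζ j ^ (γ₀ + k * Δγ))
    (H₀ H₁ : Matrix (Fin N) (Fin N) ℂ)
    (hH₀ : ∀ a b, H₀ a b = G ((a : ℕ) + (b : ℕ)))
    (hH₁ : ∀ a b, H₁ a b = G ((a : ℕ) + (b : ℕ) + 1)) :
    ∀ lam : ℂ, (H₁ - lam • H₀).det = 0 ↔ ∃ i : Fin N, lam = ζ i ^ Δγ := by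
  intro lam
  have hmoment (k : ℕ) : G k = ∑ j, ((n j : ℂ) * ζ j ^ γ₀) * (ζ j ^ Δγ) ^ k := by
    rw [hG]
    exact Finset.sum_congr rfl fun j _ => by ring
  have h₀ : H₀ = Matrix.of fun a b : Fin N =>
      ∑ j, ((n j : ℂ) * ζ j ^ γ₀) * (ζ j ^ Δγ) ^ ((a : ℕ) + b) := by
    ext a b
    rw [hH₀, hmoment, Matrix.of_apply]
  have h₁ : H₁ = Matrix.of fun a b : Fin N =>
      ∑ j, ((n j : ℂ) * ζ j ^ γ₀) * (ζ j ^ Δγ) ^ ((a : ℕ) + b + 1) := by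
    ext a b
    rw [hH₁, hmoment, Matrix.of_apply]
  rw [h₀, h₁]
  exact Matrix.det_hankel_pencil_eq_zero_iff
    (fun j => mul_ne_zero (Int.cast_ne_zero.mpr (hn j)) (pow_ne_zero _ (hζ j))) hdist lam
end

section
/- (Step of Theorem 3.) Fix m ∈ ℕ and define moments G^{(m)}_k = Σ_{j=1}^N n_j ζ_j^{m+k}. Let H^{(m)}_{0,N+1} and H^{(m)}_{1,N+1} be the (N+1)×(N+1) Hankel matrices with entries G^{(m)}_{a+b} and G^{(m)}_{a+b+1} respectively (0 ≤ a,b ≤ N), and for i, j ∈ {1,…,N+1} let M^{(m)}_{0,ij} and M^{(m)}_{1,ij} be the N×N submatrices obtained by deleting row i and column j. Then for every k ∈ {1,…,N} and every i, j ∈ {1,…,N+1}, det(M^{(m)}_{1,ij} − ζ_k · M^{(m)}_{0,ij}) = 0; that is, each ζ_k is an eigenvalue of every N×N minor pencil of the extended Hankel pencil. -/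
/-- **Step of Theorem 3.** Every `ζ_k` is an eigenvalue of every `N×N` minor pencil
of the extended `(N+1)×(N+1)` Hankel pencil:
`det (M^{(m)}_{1,ij} − ζ_k M^{(m)}_{0,ij}) = 0` for all `k, i, j`. -/
theorem zeros_are_eigenvalues_of_minor_pencils
    (N : ℕ) (hN : 1 ≤ N)
    (ζ : Fin N → ℂ) (hζ : ∀ j, ζ j ≠ 0) (hinj : Function.Injective ζ)
    (n : Fin N → ℤ) (hn : ∀ j, n j ≠ 0)
    (m : ℕ)
    (G : ℕ → ℂ) (hG : ∀ k, G k = ∑ j, (n j : ℂ) * ζ j ^ (m + k))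
    (H₀ H₁ : Matrix (Fin (N + 1)) (Fin (N + 1)) ℂ)
    (hH₀ : ∀ a b, H₀ a b = G ((a : ℕ) + (b : ℕ)))
    (hH₁ : ∀ a b, H₁ a b = G ((a : ℕ) + (b : ℕ) + 1)) :
    ∀ (k : Fin N) (i j : Fin (N + 1)),
      (H₁.submatrix i.succAbove j.succAbove -
        ζ k • H₀.submatrix i.succAbove j.succAbove).det = 0 := by
  intro k i j
  have hfactor : H₁.submatrix i.succAbove j.succAbove -
      ζ k • H₀.submatrix i.succAbove j.succAbove =
      Matrix.of (fun a l => ζ l ^ (i.succAbove a : ℕ)) *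
        Matrix.diagonal (fun l => (n l : ℂ) * ζ l ^ m * (ζ l - ζ k)) *
        Matrix.of (fun l b => ζ l ^ (j.succAbove b : ℕ)) := by
    ext a b
    simp only [Matrix.sub_apply, Matrix.smul_apply, Matrix.submatrix_apply, smul_eq_mul, hH₀, hH₁,
      hG, Matrix.mul_apply (M := _ * _), Matrix.mul_diagonal, Matrix.of_apply, Finset.mul_sum,
      ← Finset.sum_sub_distrib]
    exact Finset.sum_congr rfl fun l _ => by ring
  have hdiag : (Matrix.diagonal (fun l => (n l : ℂ) * ζ l ^ m * (ζ l - ζ k))).det = 0 := by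
    rw [Matrix.det_diagonal]
    exact Finset.prod_eq_zero (Finset.mem_univ k) (by simp)
  rw [hfactor, Matrix.det_mul, Matrix.det_mul, hdiag, mul_zero, zero_mul]
end

section
/- (Theorem 3, rank formulation for the uncorrupted extended pencil.) Define moments Ḡ_k = Σ_{j=1}^N n_j ζ_j^{k} and, for p ≥ 1, the (N+p)×(N+p) Hankel matrices (H_{0,N+p})_{ab} = Ḡ_{a+b} and (H_{1,N+p})_{ab} = Ḡ_{a+b+1} (0 ≤ a,b ≤ N+p−1). Then for every λ ∈ ℂ: if λ ∉ {ζ₁,…,ζ_N} the matrix H_{1,N+p} − λ H_{0,N+p} has rank exactly N, while if λ = ζ_k for some k its rank is at most N−1. In particular the eigenvalues ζ₁,…,ζ_N of the pencil H_{1,N} − λH_{0,N} are also rank-dropping values of the extended pencil H_{1,N+p} − λH_{0,N+p}, independently of p. -/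
open Matrix in
/-- A rectangular Vandermonde matrix with distinct nodes and at least as many columns as rows
preserves the rank of a matrix under congruence. -/
theorem rank_vandermonde_congruence {K : Type*} [Field K] {N p : ℕ} {v : Fin N → K}
    (hv : Function.Injective v) (D : Matrix (Fin N) (Fin N) K) :
    ((of fun (j : Fin N) (a : Fin (N + p)) => v j ^ (a : ℕ))ᵀ * D *
      of fun (j : Fin N) (a : Fin (N + p)) => v j ^ (a : ℕ)).rank = D.rank := by
  set W : Matrix (Fin N) (Fin (N + p)) K := of fun j a => v j ^ (a : ℕ) with hW
  refine le_antisymm ((rank_mul_le_left _ _).trans (rank_mul_le_right _ _)) ?_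
  have hdet : (vandermonde v).det ≠ 0 := det_vandermonde_ne_zero_iff.mpr hv
  have hsub : (Wᵀ * D * W).submatrix (Fin.castAdd p) (Fin.castAdd p) =
      (vandermonde v)ᵀ * D * vandermonde v := by
    ext a b
    simp [hW, mul_apply, vandermonde_apply]
  calc D.rank = ((vandermonde v)ᵀ * D * vandermonde v).rank := by
        rw [rank_mul_eq_left_of_det_ne_zero _ _ hdet,
          rank_mul_eq_right_of_det_ne_zero _ _ (by rwa [det_transpose])]
    _ ≤ (Wᵀ * D * W).rank := hsub ▸ rank_submatrix_le _ _ _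

open Matrix in
/-- The Hankel pencil of the moments `∑ j, c j * v j ^ k` factors through the nodes. -/
theorem hankel_pencil_eq_vandermonde_congruence {K : Type*} [CommRing K] {N M : ℕ}
    (v c : Fin N → K) (G : ℕ → K) (hG : ∀ k, G k = ∑ j, c j * v j ^ k) (lam : K) :
    (of fun a b : Fin M => G ((a : ℕ) + (b : ℕ) + 1)) -
        lam • (of fun a b : Fin M => G ((a : ℕ) + (b : ℕ))) =
      (of fun (j : Fin N) (a : Fin M) => v j ^ (a : ℕ))ᵀ *
        diagonal (fun j => c j * (v j - lam)) *
          of fun (j : Fin N) (a : Fin M) => v j ^ (a : ℕ) := by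
  ext a b
  rw [mul_apply]
  simp only [Matrix.sub_apply, Matrix.smul_apply, of_apply, hG, mul_diagonal, transpose_apply,
    smul_eq_mul, Finset.mul_sum, ← Finset.sum_sub_distrib]
  exact Finset.sum_congr rfl fun j _ => by ring

/-- **Theorem 3, rank formulation for the uncorrupted extended pencil.** For every
`p ≥ 1` and `λ ∈ ℂ`, the extended Hankel pencil `H_{1,N+p} − λ H_{0,N+p}` has rank
exactly `N` when `λ ∉ {ζ₁,…,ζ_N}`, and rank at most `N − 1` when `λ = ζ_k`:
the eigenvalues `ζ₁,…,ζ_N` are rank-dropping values of the extended pencil,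
independently of `p`. -/
theorem extended_hankel_pencil_rank
    (N : ℕ) (hN : 1 ≤ N)
    (ζ : Fin N → ℂ) (hζ : ∀ j, ζ j ≠ 0) (hinj : Function.Injective ζ)
    (n : Fin N → ℤ) (hn : ∀ j, n j ≠ 0)
    (G : ℕ → ℂ) (hG : ∀ k, G k = ∑ j, (n j : ℂ) * ζ j ^ k) :
    ∀ p : ℕ, 1 ≤ p → ∀ lam : ℂ,
      ((∀ k : Fin N, lam ≠ ζ k) →
        ((Matrix.of fun a b : Fin (N + p) => G ((a : ℕ) + (b : ℕ) + 1)) -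
          lam • (Matrix.of fun a b : Fin (N + p) =>
            G ((a : ℕ) + (b : ℕ)))).rank = N) ∧
      (∀ k : Fin N, lam = ζ k →
        ((Matrix.of fun a b : Fin (N + p) => G ((a : ℕ) + (b : ℕ) + 1)) -
          lam • (Matrix.of fun a b : Fin (N + p) =>
            G ((a : ℕ) + (b : ℕ)))).rank ≤ N - 1) := by
  classical
  intro p _ lam
  rw [hankel_pencil_eq_vandermonde_congruence ζ (fun j => (n j : ℂ)) G hG,
    rank_vandermonde_congruence hinj, Matrix.rank_diagonal]
  refine ⟨fun hlam => ?_, fun k hk => ?_⟩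
  · have hne : ∀ j, (n j : ℂ) * (ζ j - lam) ≠ 0 := fun j =>
      mul_ne_zero (Int.cast_ne_zero.mpr (hn j)) (sub_ne_zero.mpr (hlam j).symm)
    simp [Fintype.card_subtype, hne]
  · have hlt : Fintype.card {j // (n j : ℂ) * (ζ j - lam) ≠ 0} < Fintype.card (Fin N) :=
      Fintype.card_subtype_lt (x := k) (by simp [hk])
    rw [Fintype.card_fin] at hlt
    exact Nat.le_sub_one_of_lt hlt
end

section
/- (Generalized argument principle, Eq. (1), for a circle.) Let c ∈ ℂ and r > 0, let a₁,…,a_N be pairwise distinct points of the open disc {z : |z − c| < r}, let n₁,…,n_N be nonzero integers, let h be a function analytic on an open neighborhood of the closed disc {z : |z − c| ≤ r} with h(z) ≠ 0 for all z in the closed disc, and define f(z) = h(z) · Π_{j=1}^N (z − a_j)^{n_j} on the closed disc minus {a₁,…,a_N}. Let g be analytic on an open neighborhood of the closed disc. Then (1/(2πi)) ∮_{|z−c|=r} g(z) · f′(z)/f(z) dz = Σ_{j=1}^N n_j · g(a_j), where the contour integral is over the positively oriented circle of radius r about c. -/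
open Metric

/-- The logarithmic derivative of a product of a nonvanishing function and integer powers of
linear factors. -/
lemma logDeriv_mul_prod_sub_zpow {ι : Type*} (s : Finset ι) (a : ι → ℂ) (n : ι → ℤ)
    {h : ℂ → ℂ} {z : ℂ} (hd : DifferentiableAt ℂ h z) (hz : h z ≠ 0)
    (ha : ∀ j ∈ s, z ≠ a j) :
    logDeriv (fun w => h w * ∏ j ∈ s, (w - a j) ^ n j) z =
      logDeriv h z + ∑ j ∈ s, n j * (z - a j)⁻¹ := by
  have hne : ∀ j ∈ s, (z - a j) ^ n j ≠ 0 := fun j hj => zpow_ne_zero _ (sub_ne_zero.2 (ha j hj))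
  have hdz : ∀ j ∈ s, DifferentiableAt ℂ (fun w => (w - a j) ^ n j) z := fun j hj =>
    (differentiableAt_id.sub_const (a j)).zpow (Or.inl (sub_ne_zero.2 (ha j hj)))
  rw [logDeriv_mul (f := h) (g := fun w => ∏ j ∈ s, (w - a j) ^ n j) z hz
    (Finset.prod_ne_zero_iff.2 hne) hd (DifferentiableAt.fun_finsetProd hdz)]
  congr 1
  rw [logDeriv_prod (f := fun j w => (w - a j) ^ n j) hne hdz]
  refine Finset.sum_congr rfl fun j _ => ?_
  rw [logDeriv_fun_zpow (f := fun w => w - a j) (differentiableAt_id.sub_const (a j))]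
  simp [logDeriv_apply]

/-- **Generalized argument principle (Eq. (1)) for a circle.** If
`f(z) = h(z) Π_j (z − a_j)^{n_j}` with `h` analytic and nonvanishing on a
neighborhood of the closed disc, the `a_j` pairwise distinct points of the open
disc, and `g` analytic on a neighborhood of the closed disc, then
`(1/(2πi)) ∮ g f'/f = Σ_j n_j g(a_j)`. -/
theorem generalized_argument_principle_circle
    (c : ℂ) (r : ℝ) (hr : 0 < r)
    (N : ℕ) (a : Fin N → ℂ)
    (ha : ∀ j, a j ∈ Metric.ball c r) (hinj : Function.Injective a)
    (n : Fin N → ℤ) (hn : ∀ j, n j ≠ 0)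
    (U : Set ℂ) (hU : IsOpen U) (hUc : Metric.closedBall c r ⊆ U)
    (h : ℂ → ℂ) (hh : DifferentiableOn ℂ h U)
    (hh0 : ∀ z ∈ Metric.closedBall c r, h z ≠ 0)
    (g : ℂ → ℂ) (hg : DifferentiableOn ℂ g U)
    (f : ℂ → ℂ) (hf : ∀ z, f z = h z * ∏ j, (z - a j) ^ (n j)) :
    (2 * Real.pi * Complex.I)⁻¹ * (∮ z in C(c, r), g z * (deriv f z / f z)) =
      ∑ j, (n j : ℂ) * g (a j) := by
  have hsub : sphere c r ⊆ closedBall c r := sphere_subset_closedBall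
  have hza : ∀ z ∈ sphere c r, ∀ j, z ≠ a j := fun z hz j hzj =>
    (mem_ball.1 (ha j)).ne (hzj ▸ mem_sphere.1 hz)
  have hgD : DifferentiableOn ℂ g (closedBall c r) := hg.mono hUc
  have hGD : DifferentiableOn ℂ (fun z => g z * logDeriv h z) (closedBall c r) :=
    hgD.mul (((hh.deriv hU).mono hUc).div (hh.mono hUc) hh0)
  have hint : ∀ j ∈ Finset.univ,
      CircleIntegrable (fun z => (n j : ℂ) * ((z - a j)⁻¹ * g z)) c r := fun j _ =>
    ContinuousOn.circleIntegrable hr.le <| continuousOn_const.mul <|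
      ((continuousOn_id.sub continuousOn_const).inv₀ fun z hz =>
        sub_ne_zero.2 (hza z hz j)).mul (hgD.continuousOn.mono hsub)
  have hcongr : Set.EqOn (fun z => g z * (deriv f z / f z))
      (fun z => g z * logDeriv h z + ∑ j, (n j : ℂ) * ((z - a j)⁻¹ * g z)) (sphere c r) := by
    intro z hz
    have hz' := hsub hz
    have key := logDeriv_mul_prod_sub_zpow Finset.univ a n
      ((hh z (hUc hz')).differentiableAt (hU.mem_nhds (hUc hz'))) (hh0 z hz')
      fun j _ => hza z hz j
    rw [← funext hf] at key
    simp only [← logDeriv_apply, key, mul_add, Finset.mul_sum]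
    congr 1
    exact Finset.sum_congr rfl fun j _ => by ring
  have hG0 : (∮ z in C(c, r), g z * logDeriv h z) = 0 :=
    (hGD.mono closure_ball_subset_closedBall).diffContOnCl.circleIntegral_eq_zero hr.le
  have hcauchy : ∀ j, (∮ z in C(c, r), (z - a j)⁻¹ * g z) = 2 * Real.pi * Complex.I * g (a j) :=
    fun j => hgD.circleIntegral_sub_inv_smul (ha j)
  rw [circleIntegral.integral_congr hr.le hcongr,
    circleIntegral.integral_add ((hGD.continuousOn.mono hsub).circleIntegrable hr.le)
      (CircleIntegrable.fun_sum _ hint),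
    circleIntegral.integral_fun_sum hint, hG0, zero_add, Finset.mul_sum]
  refine Finset.sum_congr rfl fun j _ => ?_
  rw [circleIntegral.integral_const_mul, hcauchy, mul_left_comm,
    inv_mul_cancel_left₀ Complex.two_pi_I_ne_zero]
end
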